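/- Let (A_k)_{k≥1} be events on a probability space satisfying the renewal property P(A_k ∩ A_i) = P(A_{k-i})·P(A_i) for all k > i ≥ 1. If ∑_{i=1}^∞ P(A_i) = ∞ then almost surely infinitely many A_i occur. -/

import Mathlib

open MeasureTheory Filter

namespace RenewalEvents

/-- The weight `1 / (1 + p 0 + ⋯ + p i)`. -/
noncomputable def weight (p : ℕ → ℝ) (i : ℕ) : ℝ := (1 + ∑ j ∈ Finset.range (i + 1), p j)⁻¹

/-- The partial sums of the Abel–Dini series `∑ p i / (1 + p 0 + ⋯ + p i)`. -/
noncomputable def dini (p : ℕ → ℝ) (n : ℕ) : ℝ := ∑ i ∈ Finset.range n, weight p i * p i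

section Deterministic

variable {p : ℕ → ℝ}

lemma one_le_one_add_sum (hp : ∀ i, 0 ≤ p i) (n : ℕ) : 1 ≤ 1 + ∑ j ∈ Finset.range n, p j :=
  le_add_of_nonneg_right (Finset.sum_nonneg fun i _ => hp i)

lemma weight_nonneg (hp : ∀ i, 0 ≤ p i) (i : ℕ) : 0 ≤ weight p i :=
  inv_nonneg.2 (zero_le_one.trans (one_le_one_add_sum hp _))

lemma weight_le_one (hp : ∀ i, 0 ≤ p i) (i : ℕ) : weight p i ≤ 1 :=
  inv_le_one_of_one_le₀ (one_le_one_add_sum hp _)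

lemma weight_antitone (hp : ∀ i, 0 ≤ p i) : Antitone (weight p) := by
  intro i j hij
  refine inv_anti₀ (zero_lt_one.trans_le (one_le_one_add_sum hp _)) ?_
  gcongr
  exact fun i _ _ => hp i

lemma dini_nonneg (hp : ∀ i, 0 ≤ p i) (n : ℕ) : 0 ≤ dini p n :=
  Finset.sum_nonneg fun i _ => mul_nonneg (weight_nonneg hp i) (hp i)

lemma log_le_two_mul_dini (hp : ∀ i, 0 ≤ p i) (hp1 : ∀ i, p i ≤ 1) (n : ℕ) :
    Real.log (1 + ∑ j ∈ Finset.range n, p j) ≤ 2 * dini p n := by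
  induction n with
  | zero => simp [dini]
  | succ n ih =>
    have hU := one_le_one_add_sum hp n
    have hV := one_le_one_add_sum hp (n + 1)
    have hw : weight p n = (1 + ∑ j ∈ Finset.range (n + 1), p j)⁻¹ := rfl
    have hL : dini p (n + 1) = dini p n + weight p n * p n := Finset.sum_range_succ _ _
    rw [hL, hw]
    rw [Finset.sum_range_succ, ← add_assoc] at hV ⊢
    set u := 1 + ∑ j ∈ Finset.range n, p j
    have h0 := hp n
    have h1 := hp1 n
    have hlog : Real.log (u + p n) - Real.log u ≤ p n / u := by
      rw [← Real.log_div (by linarith) (by linarith)]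
      refine (Real.log_le_sub_one_of_pos (by positivity)).trans (le_of_eq ?_)
      field_simp
      ring
    have hfrac : p n / u ≤ 2 * ((u + p n)⁻¹ * p n) := by
      rw [inv_mul_eq_div, ← mul_div_assoc, div_le_div_iff₀ (by linarith) (by linarith)]
      nlinarith
    linarith

lemma tendsto_dini (hp : ∀ i, 0 ≤ p i) (hp1 : ∀ i, p i ≤ 1)
    (h : Tendsto (fun n => ∑ j ∈ Finset.range n, p j) atTop atTop) :
    Tendsto (dini p) atTop atTop := by
  have h2 : Tendsto (fun n => 2 * dini p n) atTop atTop :=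
    tendsto_atTop_mono (log_le_two_mul_dini hp hp1)
      (Real.tendsto_log_atTop.comp (tendsto_atTop_add_const_left _ 1 h))
  exact (tendsto_const_mul_atTop_of_pos two_pos).1 h2

lemma sum_weight_mul_shift_le (hp : ∀ i, 0 ≤ p i) (i n : ℕ) :
    ∑ j ∈ Finset.Ico (i + 1) n, weight p j * p (j - i) ≤
      1 + ∑ j ∈ Finset.Ico (i + 1) n, weight p j * p j := by
  have hterm : ∀ k, weight p (i + k) * p k ≤
      (if k ≤ i then weight p i * p k else weight p k * p k) := by
    intro k
    split_ifs <;> exact mul_le_mul_of_nonneg_right (weight_antitone hp (by omega)) (hp k)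
  have hnn : ∀ k, 0 ≤ (if k ≤ i then weight p i * p k else weight p k * p k) := by
    intro k
    split_ifs <;> exact mul_nonneg (weight_nonneg hp _) (hp k)
  have hhead : ∑ k ∈ Finset.range (i + 1), weight p i * p k ≤ 1 := by
    have h1 := one_le_one_add_sum hp (i + 1)
    rw [← Finset.mul_sum, weight, inv_mul_le_iff₀ (by linarith)]
    linarith
  calc ∑ j ∈ Finset.Ico (i + 1) n, weight p j * p (j - i)
      = ∑ k ∈ Finset.Ico 1 (n - i), weight p (i + k) * p k := by
        refine Finset.sum_nbij' (fun j => j - i) (fun k => i + k) ?_ ?_ ?_ ?_ ?_ <;>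
          intro j hj <;> rw [Finset.mem_Ico] at hj
        · rw [Finset.mem_Ico]; omega
        · rw [Finset.mem_Ico]; omega
        · show i + (j - i) = j
          omega
        · show i + j - i = j
          omega
        · show _ = weight p (i + (j - i)) * p (j - i)
          rw [Nat.add_sub_cancel' (by omega)]
    _ ≤ ∑ k ∈ Finset.Ico 1 (n - i),
          (if k ≤ i then weight p i * p k else weight p k * p k) :=
        Finset.sum_le_sum fun k _ => hterm k
    _ ≤ ∑ k ∈ Finset.range (i + 1) ∪ Finset.Ico (i + 1) n,
          (if k ≤ i then weight p i * p k else weight p k * p k) := by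
        refine Finset.sum_le_sum_of_subset_of_nonneg ?_ fun k _ _ => hnn k
        intro k hk
        simp only [Finset.mem_Ico, Finset.mem_union, Finset.mem_range] at hk ⊢
        omega
    _ = ∑ k ∈ Finset.range (i + 1), weight p i * p k +
          ∑ j ∈ Finset.Ico (i + 1) n, weight p j * p j := by
        rw [Finset.sum_union]
        · congr 1
          · refine Finset.sum_congr rfl fun k hk => if_pos ?_
            rw [Finset.mem_range] at hk; omega
          · refine Finset.sum_congr rfl fun k hk => if_neg ?_
            rw [Finset.mem_Ico] at hk; omega
        · rw [Finset.disjoint_left]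
          intro k hk hk2
          simp only [Finset.mem_Ico, Finset.mem_range] at hk hk2
          omega
    _ ≤ _ := by linarith

lemma sum_range_sum_range_eq (f : ℕ → ℕ → ℝ) (n : ℕ) :
    ∑ j ∈ Finset.range n, ∑ i ∈ Finset.range j, f i j =
      ∑ i ∈ Finset.range n, ∑ j ∈ Finset.Ico (i + 1) n, f i j := by
  refine Finset.sum_comm' fun i j => ?_
  simp only [Finset.mem_range, Finset.mem_Ico]
  omega

lemma sq_sum_range (a : ℕ → ℝ) (n : ℕ) :
    (∑ i ∈ Finset.range n, a i) ^ 2 =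
      ∑ j ∈ Finset.range n, a j ^ 2 + 2 * ∑ j ∈ Finset.range n, ∑ i ∈ Finset.range j, a i * a j := by
  induction n with
  | zero => simp
  | succ n ih =>
    simp only [Finset.sum_range_succ _ n]
    rw [add_sq, ih, ← Finset.sum_mul]
    ring

lemma second_moment_le (hp : ∀ i, 0 ≤ p i) (n : ℕ) :
    ∑ j ∈ Finset.range n, weight p j ^ 2 * p j +
      2 * ∑ j ∈ Finset.range n, ∑ i ∈ Finset.range j,
        weight p i * weight p j * (p (j - i) * p i) ≤ dini p n ^ 2 + 3 * dini p n := by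
  have hdiag : ∑ j ∈ Finset.range n, weight p j ^ 2 * p j ≤ dini p n := by
    refine Finset.sum_le_sum fun j _ => mul_le_mul_of_nonneg_right ?_ (hp j)
    exact pow_le_of_le_one (weight_nonneg hp j) (weight_le_one hp j) two_ne_zero
  have hoff : ∑ j ∈ Finset.range n, ∑ i ∈ Finset.range j,
        weight p i * weight p j * (p (j - i) * p i) ≤
      dini p n + ∑ j ∈ Finset.range n, ∑ i ∈ Finset.range j,
        (weight p i * p i) * (weight p j * p j) := by
    rw [sum_range_sum_range_eq, sum_range_sum_range_eq, dini, ← Finset.sum_add_distrib]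
    refine Finset.sum_le_sum fun i _ => ?_
    calc ∑ j ∈ Finset.Ico (i + 1) n, weight p i * weight p j * (p (j - i) * p i)
        = weight p i * p i * ∑ j ∈ Finset.Ico (i + 1) n, weight p j * p (j - i) := by
          rw [Finset.mul_sum]
          exact Finset.sum_congr rfl fun j _ => by ring
      _ ≤ weight p i * p i * (1 + ∑ j ∈ Finset.Ico (i + 1) n, weight p j * p j) :=
          mul_le_mul_of_nonneg_left (sum_weight_mul_shift_le hp i n)
            (mul_nonneg (weight_nonneg hp i) (hp i))
      _ = _ := by rw [mul_add, mul_one, Finset.mul_sum]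
  have hsq := sq_sum_range (fun i => weight p i * p i) n
  have hnn : 0 ≤ ∑ j ∈ Finset.range n, (weight p j * p j) ^ 2 :=
    Finset.sum_nonneg fun j _ => sq_nonneg _
  rw [← dini] at hsq
  linarith

end Deterministic

/-- The weighted number of the events `B 0, …, B (n - 1)` that occur. -/
noncomputable def count {Ω : Type*} (w : ℕ → ℝ) (B : ℕ → Set Ω) (n : ℕ) (ω : Ω) : ℝ :=
  ∑ i ∈ Finset.range n, w i * (B i).indicator 1 ω

lemma exists_count_le {Ω : Type*} (w : ℕ → ℝ) {B : ℕ → Set Ω} {ω : Ω}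
    (h : ∀ᶠ i in atTop, ω ∉ B i) : ∃ M : ℕ, ∀ n, count w B n ω ≤ M := by
  obtain ⟨N, hN⟩ := eventually_atTop.1 h
  obtain ⟨M, hM⟩ := exists_nat_ge (∑ i ∈ Finset.range N, |w i * (B i).indicator 1 ω|)
  refine ⟨M, fun n => le_trans ?_ hM⟩
  calc count w B n ω ≤ ∑ i ∈ Finset.range n, |w i * (B i).indicator 1 ω| :=
        Finset.sum_le_sum fun i _ => le_abs_self _
    _ ≤ ∑ i ∈ Finset.range (n + N), |w i * (B i).indicator 1 ω| :=
        Finset.sum_le_sum_of_subset_of_nonneg (by gcongr; omega) fun i _ _ => abs_nonneg _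
    _ = ∑ i ∈ Finset.range N, |w i * (B i).indicator 1 ω| := by
        symm
        refine Finset.sum_subset (by gcongr; omega) fun i _ hi => ?_
        rw [Finset.mem_range, not_lt] at hi
        simp [hN i hi]

section Probability

variable {Ω : Type*} [MeasurableSpace Ω] {μ : Measure Ω}

lemma measurable_count (w : ℕ → ℝ) {B : ℕ → Set Ω} (hB : ∀ k, MeasurableSet (B k)) (n : ℕ) :
    Measurable (count w B n) :=
  Finset.measurable_fun_sum _ fun i _ =>
    (measurable_one.indicator (hB i)).const_mul (w i)

lemma integral_sq_count_sub [IsProbabilityMeasure μ] (w : ℕ → ℝ) {B : ℕ → Set Ω}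
    (hB : ∀ k, MeasurableSet (B k)) (n : ℕ) (c : ℝ) :
    Integrable (fun ω => (count w B n ω - c) ^ 2) μ ∧
    ∫ ω, (count w B n ω - c) ^ 2 ∂μ =
      (∑ j ∈ Finset.range n, w j ^ 2 * μ.real (B j) +
        2 * ∑ j ∈ Finset.range n, ∑ i ∈ Finset.range j, w i * w j * μ.real (B j ∩ B i)) -
      2 * c * ∑ j ∈ Finset.range n, w j * μ.real (B j) + c ^ 2 := by
  have hint : ∀ s, MeasurableSet s → Integrable (s.indicator (1 : Ω → ℝ)) μ := fun s hs =>
    (integrable_const (1 : ℝ)).indicator hs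
  have hexp : (fun ω => (count w B n ω - c) ^ 2) = fun ω =>
      (∑ j ∈ Finset.range n, w j ^ 2 * (B j).indicator (1 : Ω → ℝ) ω +
        2 * ∑ j ∈ Finset.range n, ∑ i ∈ Finset.range j,
          w i * w j * (B j ∩ B i).indicator (1 : Ω → ℝ) ω) -
      2 * c * ∑ j ∈ Finset.range n, w j * (B j).indicator (1 : Ω → ℝ) ω + c ^ 2 := by
    funext ω
    rw [sub_sq, count, sq_sum_range]
    have h1 : ∀ j, (w j * (B j).indicator (1 : Ω → ℝ) ω) ^ 2 =
        w j ^ 2 * (B j).indicator (1 : Ω → ℝ) ω := by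
      intro j
      by_cases h : ω ∈ B j <;> simp [h]
    have h2 : ∀ i j, w i * (B i).indicator (1 : Ω → ℝ) ω * (w j * (B j).indicator (1 : Ω → ℝ) ω) =
        w i * w j * (B j ∩ B i).indicator (1 : Ω → ℝ) ω := by
      intro i j
      by_cases h : ω ∈ B j <;> by_cases h' : ω ∈ B i <;> simp [h, h']
    simp only [h1, h2]
    ring
  have i1 : ∀ j, Integrable (fun ω => w j ^ 2 * (B j).indicator (1 : Ω → ℝ) ω) μ :=
    fun j => (hint _ (hB j)).const_mul _
  have i2 : ∀ i j, Integrable (fun ω => w i * w j * (B j ∩ B i).indicator (1 : Ω → ℝ) ω) μ :=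
    fun i j => (hint _ ((hB j).inter (hB i))).const_mul _
  have i3 : ∀ j, Integrable (fun ω => w j * (B j).indicator (1 : Ω → ℝ) ω) μ :=
    fun j => (hint _ (hB j)).const_mul _
  have s1 := integrable_finsetSum (Finset.range n) fun j _ => i1 j
  have s2' := fun j => integrable_finsetSum (Finset.range j) fun i _ => i2 i j
  have s2 := (integrable_finsetSum (Finset.range n) fun j _ => s2' j).const_mul 2
  have s3 := (integrable_finsetSum (Finset.range n) fun j _ => i3 j).const_mul (2 * c)
  rw [hexp]
  have s12 := s1.fun_add s2
  have s123 : Integrable (fun ω =>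
      (∑ j ∈ Finset.range n, w j ^ 2 * (B j).indicator (1 : Ω → ℝ) ω +
        2 * ∑ j ∈ Finset.range n, ∑ i ∈ Finset.range j,
          w i * w j * (B j ∩ B i).indicator (1 : Ω → ℝ) ω) -
      2 * c * ∑ j ∈ Finset.range n, w j * (B j).indicator (1 : Ω → ℝ) ω) μ := s12.sub s3
  refine ⟨s123.fun_add (integrable_const _), ?_⟩
  rw [integral_add s123 (integrable_const _), integral_sub s12 s3,
    integral_add s1 s2, integral_const_mul, integral_const_mul,
    integral_finsetSum _ fun j _ => i1 j, integral_finsetSum _ fun j _ => s2' j,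
    integral_finsetSum _ fun j _ => i3 j]
  simp only [integral_finsetSum _ fun i _ => i2 i _, integral_const_mul,
    integral_indicator_one (hB _), integral_indicator_one ((hB _).inter (hB _))]
  simp

lemma integral_sq_count_sub_dini_le [IsProbabilityMeasure μ] {B : ℕ → Set Ω}
    (hB : ∀ k, MeasurableSet (B k))
    (hrenew : ∀ i k, i < k → μ.real (B k ∩ B i) = μ.real (B (k - i)) * μ.real (B i)) (n : ℕ) :
    ∫ ω, (count (weight fun i => μ.real (B i)) B n ω - dini (fun i => μ.real (B i)) n) ^ 2 ∂μ ≤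
      3 * dini (fun i => μ.real (B i)) n := by
  have h := second_moment_le (p := fun i => μ.real (B i)) (fun _ => measureReal_nonneg) n
  rw [(integral_sq_count_sub _ hB n _).2]
  rw [Finset.sum_congr rfl fun j _ => Finset.sum_congr rfl fun i hi => by
    rw [hrenew i j (Finset.mem_range.1 hi)]]
  have hd : ∑ j ∈ Finset.range n, weight (fun i => μ.real (B i)) j * μ.real (B j) =
    dini (fun i => μ.real (B i)) n := rfl
  rw [hd]
  linarith

lemma measure_count_bounded_eq_zero [IsProbabilityMeasure μ] {B : ℕ → Set Ω}
    (hB : ∀ k, MeasurableSet (B k))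
    (hrenew : ∀ i k, i < k → μ.real (B k ∩ B i) = μ.real (B (k - i)) * μ.real (B i))
    (hdiv : Tendsto (fun n => ∑ j ∈ Finset.range n, μ.real (B j)) atTop atTop) (M : ℝ) :
    μ {ω | ∀ n, count (weight fun i => μ.real (B i)) B n ω ≤ M} = 0 := by
  set p : ℕ → ℝ := fun i => μ.real (B i)
  set F := {ω | ∀ n, count (weight p) B n ω ≤ M} with hF
  have hFm : MeasurableSet F := by
    rw [hF, Set.ofPred_forall]
    exact MeasurableSet.iInter fun n => measurableSet_le (measurable_count _ hB n) measurable_const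
  have hL := tendsto_dini (p := p) (fun _ => measureReal_nonneg) (fun _ => measureReal_le_one) hdiv
  have hbound : ∀ n, M ≤ dini p n → (dini p n - M) ^ 2 * μ.real F ≤ 3 * dini p n := by
    intro n hn
    refine le_trans ?_ (integral_sq_count_sub_dini_le hB hrenew n)
    have hint := (integral_sq_count_sub (μ := μ) (weight p) hB n (dini p n)).1
    calc (dini p n - M) ^ 2 * μ.real F = ∫ _ in F, (dini p n - M) ^ 2 ∂μ := by
          simp [mul_comm]
      _ ≤ ∫ ω in F, (count (weight p) B n ω - dini p n) ^ 2 ∂μ := by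
          refine setIntegral_mono_on (integrable_const _).integrableOn hint.integrableOn hFm ?_
          intro ω hω
          have := hω n
          nlinarith
      _ ≤ _ := setIntegral_le_integral hint (ae_of_all _ fun ω => sq_nonneg _)
  by_contra hne
  have hpos : 0 < μ.real F := by
    rw [measureReal_def]
    exact ENNReal.toReal_pos hne (measure_ne_top _ _)
  obtain ⟨n, hn⟩ := (hL.eventually_ge_atTop (2 * |M| + 1 + 13 / μ.real F)).exists
  have hq : 0 < 13 / μ.real F := by positivity
  have hM := le_abs_self M
  have hM0 := abs_nonneg M
  have hb := hbound n (by linarith)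
  have hhalf : dini p n / 2 ≤ dini p n - M := by linarith
  have hsq : (dini p n / 2) ^ 2 ≤ (dini p n - M) ^ 2 :=
    pow_le_pow_left₀ (by linarith) hhalf 2
  have hlarge : 13 ≤ dini p n * μ.real F := by
    rw [← div_le_iff₀ hpos]
    linarith
  nlinarith [mul_le_mul_of_nonneg_right hsq hpos.le]

lemma ae_frequently_mem [IsProbabilityMeasure μ] {B : ℕ → Set Ω}
    (hB : ∀ k, MeasurableSet (B k))
    (hrenew : ∀ i k, i < k → μ.real (B k ∩ B i) = μ.real (B (k - i)) * μ.real (B i))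
    (hdiv : Tendsto (fun n => ∑ j ∈ Finset.range n, μ.real (B j)) atTop atTop) :
    ∀ᵐ ω ∂μ, ∃ᶠ i in atTop, ω ∈ B i := by
  have h : ∀ᵐ ω ∂μ, ∀ M : ℕ, ¬ ∀ n, count (weight fun i => μ.real (B i)) B n ω ≤ M := by
    rw [ae_all_iff]
    intro M
    rw [ae_iff]
    simpa only [not_not] using measure_count_bounded_eq_zero hB hrenew hdiv M
  filter_upwards [h] with ω hω hfin
  obtain ⟨M, hM⟩ := exists_count_le (weight fun i => μ.real (B i)) hfin
  exact hω M hM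

end Probability

lemma tendsto_sum_measureReal {Ω : Type*} [MeasurableSpace Ω] {μ : Measure Ω} [IsFiniteMeasure μ]
    {B : ℕ → Set Ω} (h : ∑' i, μ (B i) = ⊤) :
    Tendsto (fun n => ∑ j ∈ Finset.range n, μ.real (B j)) atTop atTop := by
  rw [← not_summable_iff_tendsto_nat_atTop_of_nonneg fun _ => measureReal_nonneg]
  intro hs
  refine hs.tsum_ofReal_ne_top ?_
  rw [← h]
  exact tsum_congr fun i => ofReal_measureReal

end RenewalEvents

/-- Second Borel–Cantelli lemma for renewal events: if `(A_k)_{k ≥ 1}` satisfy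
`P(A_k ∩ A_i) = P(A_{k-i})·P(A_i)` for `k > i ≥ 1` and `∑ P(A_i) = ∞`, then almost
surely infinitely many of the `A_i` occur. -/
theorem stmt_10 {Ω : Type*} [MeasurableSpace Ω] (μ : Measure Ω) [IsProbabilityMeasure μ]
    (A : ℕ → Set Ω) (hA : ∀ k, MeasurableSet (A k))
    (hrenew : ∀ i k : ℕ, 1 ≤ i → i < k → μ (A k ∩ A i) = μ (A (k - i)) * μ (A i))
    (hdiv : ∑' i : ℕ, μ (A (i + 1)) = ⊤) :
    μ (limsup (fun i => A (i + 1)) atTop) = 1 := by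
  let B : ℕ → Set Ω := fun k => if k = 0 then ∅ else A k
  have hB0 : B 0 = ∅ := rfl
  have hBs : ∀ k, k ≠ 0 → B k = A k := fun k hk => if_neg hk
  have hBm : ∀ k, MeasurableSet (B k) := by
    intro k
    rcases eq_or_ne k 0 with rfl | hk
    · exact MeasurableSet.empty
    · exact hBs k hk ▸ hA k
  have hBr : ∀ i k, i < k → μ.real (B k ∩ B i) = μ.real (B (k - i)) * μ.real (B i) := by
    intro i k hik
    rcases eq_or_ne i 0 with rfl | hi
    · simp [hB0]
    · rw [hBs k (by omega), hBs i hi, hBs (k - i) (by omega), measureReal_def,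
        hrenew i k (by omega) hik, ENNReal.toReal_mul, measureReal_def, measureReal_def]
  have hBd : ∑' i, μ (B i) = ⊤ := by
    rw [tsum_eq_zero_add' ENNReal.summable, hB0, measure_empty, zero_add]
    exact hdiv
  have hae := RenewalEvents.ae_frequently_mem hBm hBr (RenewalEvents.tendsto_sum_measureReal hBd)
  rw [← prob_compl_eq_zero_iff (MeasurableSet.measurableSet_limsup fun i => hA (i + 1))]
  rw [← mem_ae_iff]
  filter_upwards [hae] with ω hω
  rw [mem_limsup_iff_frequently_mem, frequently_atTop]
  intro N
  obtain ⟨k, hk, hmem⟩ := frequently_atTop.1 hω (N + 1)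
  refine ⟨k - 1, by omega, ?_⟩
  rw [Nat.sub_add_cancel (by omega)]
  rwa [hBs k (by omega)] at hmem
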